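/- arXiv:1803.08970 — 7 statements merged into one kernel-verified Lean document; each statement's English description precedes it below -/
import Mathlib

section
/- Let f: ℝⁿ×ℝᵐ → ℝⁿ be such that for every pair of compact sets X₁ ⊂ ℝⁿ, 𝒰 ⊂ ℝᵐ there exists T' > 0 such that for every (x₀,u) ∈ X₁×𝒰 the initial value problem ẏ(t) = f(y(t),u), y(0) = x₀ (with u held constant) has a unique solution φ_u(·,x₀) on [0,T']; define the exact discrete-time model F^e(x₀,u,T) := φ_u(T,x₀). Define the Euler model F^{Euler}(x,u,T) := x + T f(x,u). Suppose: (i) F^a is consistent with F^{Euler}; and (ii) for every pair of compact sets X ⊂ ℝⁿ and 𝒰 ⊂ ℝᵐ there exist ρ of class K and M>0 such that for all (x,u),(y,u) ∈ X×𝒰: |f(y,u)| ≤ M and |f(y,u) − f(x,u)| ≤ ρ(|y−x|). Then F^a is consistent with F^e, i.e. for each compact Ω ⊂ ℝⁿ×ℝᵐ there exist ρ₁ of class K and T₀>0 such that |F^e(x,u,T) − F^a(x,u,T)| ≤ T ρ₁(T) for all (x,u) ∈ Ω and all T ∈ [0,T₀]. (Lemma 1 of the paper.) -/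
open scoped BigOperators

noncomputable section

abbrev Euc (n : ℕ) := EuclideanSpace ℝ (Fin n)

/-- Class-K function (continuous, strictly increasing on `[0,∞)`, zero at zero). -/
def IsClassK (α : ℝ → ℝ) : Prop :=
  ContinuousOn α (Set.Ici 0) ∧ StrictMonoOn α (Set.Ici 0) ∧ α 0 = 0

/-- `Fa` is (one-step) consistent with `Fb`. -/
def Consistent {n m : ℕ} (Fa Fb : Euc n → Euc m → ℝ → Euc n) : Prop :=
  ∀ Ω : Set (Euc n × Euc m), IsCompact Ω →
    ∃ ρ : ℝ → ℝ, IsClassK ρ ∧ ∃ T0 > (0:ℝ),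
      ∀ p ∈ Ω, ∀ T ∈ Set.Icc (0:ℝ) T0,
        ‖Fb p.1 p.2 T - Fa p.1 p.2 T‖ ≤ T * ρ T

/-- A curve through `φ 0` whose velocity is bounded by `M` as long as it stays in the unit ball around
`φ 0` moves with speed less than `M + 1` for small times. -/
theorem norm_sub_le_of_velocity_bound {E : Type*} [NormedAddCommGroup E] [NormedSpace ℝ E]
    {φ v : ℝ → E} {M T : ℝ} (hM : 0 ≤ M) (hT : (M + 1) * T ≤ 1)
    (hφ : ∀ t ∈ Set.Icc 0 T, HasDerivAt φ (v t) t)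
    (hv : ∀ t ∈ Set.Icc 0 T, ‖φ t - φ 0‖ ≤ 1 → ‖v t‖ ≤ M) :
    ∀ t ∈ Set.Icc 0 T, ‖φ t - φ 0‖ ≤ (M + 1) * t := by
  have hd : ∀ t ∈ Set.Icc 0 T, HasDerivAt (fun s => φ s - φ 0) (v t) t :=
    fun t ht => (hφ t ht).sub_const _
  refine image_norm_le_of_norm_deriv_right_lt_deriv_boundary (f' := v) (B' := fun _ => M + 1)
    (fun t ht => (hd t ht).continuousAt.continuousWithinAt)
    (fun t ht => (hd t (Set.Ico_subset_Icc_self ht)).hasDerivWithinAt) (by simp)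
    (fun t => by simpa using (hasDerivAt_id t).const_mul (M + 1)) ?_
  intro t ht h
  have h1 : ‖φ t - φ 0‖ ≤ 1 := by
    rw [h]
    exact (mul_le_mul_of_nonneg_left ht.2.le (by linarith)).trans hT
  linarith [hv t (Set.Ico_subset_Icc_self ht) h1]

/-- The error of the Euler step is bounded by the step size times the variation of the velocity. -/
theorem norm_sub_euler_le {E : Type*} [NormedAddCommGroup E] [NormedSpace ℝ E]
    {φ v : ℝ → E} {w : E} {C T : ℝ} (hT : 0 ≤ T)
    (hφ : ∀ t ∈ Set.Icc 0 T, HasDerivAt φ (v t) t)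
    (hv : ∀ t ∈ Set.Icc 0 T, ‖v t - w‖ ≤ C) :
    ‖φ T - (φ 0 + T • w)‖ ≤ T * C := by
  have hd : ∀ t ∈ Set.Icc 0 T, HasDerivAt (fun s => φ s - s • w) (v t - w) t := fun t ht => by
    simpa using (hφ t ht).fun_sub ((hasDerivAt_id t).smul_const w)
  have h := norm_image_sub_le_of_norm_deriv_le_segment'
    (fun t ht => (hd t ht).hasDerivWithinAt)
    (fun t ht => hv t (Set.Ico_subset_Icc_self ht)) T (Set.right_mem_Icc.2 hT)
  have e : φ T - (φ 0 + T • w) = φ T - T • w - (φ 0 - (0 : ℝ) • w) := by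
    rw [zero_smul]
    abel
  rw [e]
  linarith

theorem IsClassK.add {α β : ℝ → ℝ} (hα : IsClassK α) (hβ : IsClassK β) :
    IsClassK (fun t => α t + β t) :=
  ⟨hα.1.add hβ.1, hα.2.1.add hβ.2.1, by simp [hα.2.2, hβ.2.2]⟩

theorem IsClassK.comp_const_mul {α : ℝ → ℝ} (hα : IsClassK α) {c : ℝ} (hc : 0 < c) :
    IsClassK (fun t => α (c * t)) := by
  have hmaps : Set.MapsTo (fun t => c * t) (Set.Ici 0) (Set.Ici 0) :=
    fun t ht => mul_nonneg hc.le ht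
  refine ⟨hα.1.comp (by fun_prop) hmaps, ?_, by simp [hα.2.2]⟩
  intro s hs t ht hst
  exact hα.2.1 (hmaps hs) (hmaps ht) (mul_lt_mul_of_pos_left hst hc)

/-- Lemma 1: sufficient conditions for consistency of `Fᵃ` with the exact model `Fᵉ`,
based only on `f` and the Euler model. -/
theorem consistent_with_exact_of_consistent_with_Euler {n m : ℕ}
    (f : Euc n → Euc m → Euc n) (Fa Fe : Euc n → Euc m → ℝ → Euc n)
    -- `Fe` is the exact discrete-time model: on compact sets of initial conditions and
    -- (constant) inputs, the IVP has a unique solution on some [0,T'] and `Fe` matches it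
    (hexact : ∀ X1 : Set (Euc n), ∀ Uc : Set (Euc m), IsCompact X1 → IsCompact Uc →
      ∃ T' > (0:ℝ), ∀ x0 ∈ X1, ∀ u ∈ Uc,
        ∃ φ : ℝ → Euc n, φ 0 = x0 ∧
          (∀ t ∈ Set.Icc (0:ℝ) T', HasDerivAt φ (f (φ t) u) t) ∧
          (∀ ψ : ℝ → Euc n, ψ 0 = x0 →
            (∀ t ∈ Set.Icc (0:ℝ) T', HasDerivAt ψ (f (ψ t) u) t) →
            ∀ t ∈ Set.Icc (0:ℝ) T', ψ t = φ t) ∧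
          (∀ T ∈ Set.Icc (0:ℝ) T', Fe x0 u T = φ T))
    -- (i) `Fa` is consistent with the Euler model
    (hEuler : Consistent Fa (fun x u T => x + T • f x u))
    -- (ii) boundedness and a class-K modulus of continuity for `f` on compact sets
    (hf : ∀ X : Set (Euc n), ∀ Uc : Set (Euc m), IsCompact X → IsCompact Uc →
      ∃ ρ : ℝ → ℝ, IsClassK ρ ∧ ∃ M > (0:ℝ),
        (∀ y ∈ X, ∀ u ∈ Uc, ‖f y u‖ ≤ M) ∧
        (∀ x ∈ X, ∀ y ∈ X, ∀ u ∈ Uc, ‖f y u - f x u‖ ≤ ρ ‖y - x‖)) :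
    Consistent Fa Fe := by
  intro Ω hΩ
  obtain ⟨ρE, hρE, TE, hTE, hE⟩ := hEuler Ω hΩ
  have hX1 : IsCompact (Prod.fst '' Ω) := hΩ.image continuous_fst
  have hUc : IsCompact (Prod.snd '' Ω) := hΩ.image continuous_snd
  obtain ⟨T', hT', hsol⟩ := hexact _ _ hX1 hUc
  obtain ⟨ρf, hρf, M, hM, hbound, hmod⟩ :=
    hf (Metric.cthickening 1 (Prod.fst '' Ω)) _ hX1.cthickening hUc
  have hM1 : 0 < M + 1 := by linarith
  refine ⟨_, hρE.add (hρf.comp_const_mul hM1), min (min T' TE) (1 / (M + 1)), by positivity, ?_⟩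
  rintro ⟨x, u⟩ hp T ⟨hT0, hT⟩
  simp only [le_min_iff] at hT
  obtain ⟨⟨hTT', hTTE⟩, hTM⟩ := hT
  have hx : x ∈ Prod.fst '' Ω := ⟨_, hp, rfl⟩
  have hu : u ∈ Prod.snd '' Ω := ⟨_, hp, rfl⟩
  obtain ⟨φ, rfl, hφ, -, hFe⟩ := hsol x hx u hu
  have hφT : ∀ t ∈ Set.Icc 0 T, HasDerivAt φ (f (φ t) u) t :=
    fun t ht => hφ t ⟨ht.1, ht.2.trans hTT'⟩
  have hnear : ∀ y, ‖y - φ 0‖ ≤ 1 → y ∈ Metric.cthickening 1 (Prod.fst '' Ω) := fun y hy =>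
    Metric.mem_cthickening_of_dist_le y _ 1 _ hx (by rwa [dist_eq_norm])
  have hTM' : (M + 1) * T ≤ 1 := by rwa [le_div_iff₀' hM1] at hTM
  have hgrow := norm_sub_le_of_velocity_bound hM.le hTM' hφT
    fun t _ h => hbound _ (hnear _ h) u hu
  have hvar : ∀ t ∈ Set.Icc 0 T, ‖f (φ t) u - f (φ 0) u‖ ≤ ρf ((M + 1) * T) := by
    intro t ht
    have h : ‖φ t - φ 0‖ ≤ (M + 1) * T :=
      (hgrow t ht).trans (mul_le_mul_of_nonneg_left ht.2 hM1.le)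
    exact (hmod _ (hnear _ (by simp)) _ (hnear _ (h.trans hTM')) u hu).trans
      (hρf.2.1.monotoneOn (norm_nonneg _) (mul_nonneg hM1.le hT0) h)
  have h1 := norm_sub_euler_le hT0 hφT hvar
  have h2 := hE _ hp T ⟨hT0, hTTE⟩
  have h3 := norm_sub_le_norm_sub_add_norm_sub (φ T) (φ 0 + T • f (φ 0) u) (Fa (φ 0) u T)
  simp only [hFe T ⟨hT0, hTT'⟩] at h2 ⊢
  linarith
end
end

section
/- Suppose the pair (U, F^a) is MSEC with (U, F^e). Then for each pair of compact sets X ⊂ ℝⁿ, E ⊂ ℝⁿ and constants L>0 and η>0 there exists T̃>0 such that the following holds: if a sampling-period sequence {T_i} with T_i ∈ (0,T̃), an error sequence {e_i}, and an initial condition ξ satisfy x^a(k,ξ,{e_i},{T_i}) ∈ X and e_k ∈ E for all k for which Σ_{i=0}^{k−1} T_i ∈ [0,L], then for those same values of k one has |x^e(k,ξ,{e_i},{T_i}) − x^a(k,ξ,{e_i},{T_i})| ≤ η, where x^a and x^e denote the solutions of x_{k+1} = F̄^a(x_k,e_k,T_k) and x_{k+1} = F̄^e(x_k,e_k,T_k),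 respectively, both with initial condition ξ. (Lemma 2 of the paper.) -/
open scoped BigOperators

noncomputable section

/-- Solution of the discrete-time system `x_{k+1} = F(x_k, e_k, T_k)`. -/
def sol {E : Type*} (F : E → E → ℝ → E) (ξ : E) (e : ℕ → E) (T : ℕ → ℝ) : ℕ → E
  | 0 => ξ
  | k + 1 => F (sol F ξ e T k) (e k) (T k)

/-- Closed-loop map `F̄(x,e,T) = F(x, U(x+e,T), T)`. -/
def Fbar {n m : ℕ} (F : Euc n → Euc m → ℝ → Euc n) (U : Euc n → ℝ → Euc m) :
    Euc n → Euc n → ℝ → Euc n :=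
  fun x e T => F x (U (x + e) T) T

/-- `k`-fold iterate `α^k(0, {T_i})`. -/
def alphaIter (a : ℝ → ℝ → ℝ) (Ts : ℕ → ℝ) : ℕ → ℝ
  | 0 => 0
  | k + 1 => a (alphaIter a Ts k) (Ts k)

/-- Multi-step error consistency of `(U, Fa)` with `(U, Fe)`. -/
def MSEC {n m : ℕ} (U : Euc n → ℝ → Euc m) (Fa Fe : Euc n → Euc m → ℝ → Euc n) : Prop :=
  ∀ L > (0:ℝ), ∀ η > (0:ℝ), ∀ X Eset : Set (Euc n), IsCompact X → IsCompact Eset →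
    ∃ a : ℝ → ℝ → ℝ, (∀ d t, 0 ≤ d → 0 ≤ t → 0 ≤ a d t) ∧
      ∃ Tstar > (0:ℝ),
        (∀ δ : ℝ, ∀ xe ∈ X, ∀ xa ∈ X, ‖xe - xa‖ ≤ δ →
          ∀ e ∈ Eset, ∀ T ∈ Set.Ioo (0:ℝ) Tstar,
            ‖Fbar Fe U xe e T - Fbar Fa U xa e T‖ ≤ a δ T) ∧
        (∀ Ts : ℕ → ℝ, (∀ i, Ts i ∈ Set.Ioo (0:ℝ) Tstar) →
          ∀ k : ℕ, (∑ i ∈ Finset.range k, Ts i) ≤ L → alphaIter a Ts k ≤ η)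

/-- Lemma 2: under MSEC, the mismatch between exact and approximate solutions over a
fixed time horizon is small for sufficiently small sampling periods. -/
theorem small_mismatch_of_MSEC {n m : ℕ} (U : Euc n → ℝ → Euc m)
    (Fa Fe : Euc n → Euc m → ℝ → Euc n) (hMSEC : MSEC U Fa Fe)
    (X Eset : Set (Euc n)) (hX : IsCompact X) (hE : IsCompact Eset)
    (L : ℝ) (hL : 0 < L) (η : ℝ) (hη : 0 < η) :
    ∃ Ttil > (0:ℝ),
      ∀ Ts : ℕ → ℝ, (∀ i, Ts i ∈ Set.Ioo 0 Ttil) →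
      ∀ e : ℕ → Euc n, ∀ ξ : Euc n,
        (∀ k : ℕ, (∑ i ∈ Finset.range k, Ts i) ≤ L →
          sol (Fbar Fa U) ξ e Ts k ∈ X ∧ e k ∈ Eset) →
        ∀ k : ℕ, (∑ i ∈ Finset.range k, Ts i) ≤ L →
          ‖sol (Fbar Fe U) ξ e Ts k - sol (Fbar Fa U) ξ e Ts k‖ ≤ η := by
  obtain ⟨a, -, Tstar, hT, hstep, hiter⟩ := hMSEC L hL η hη (Metric.cthickening η X) Eset
    hX.cthickening hE
  refine ⟨Tstar, hT, fun Ts hTs e ξ hinv => ?_⟩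
  have key : ∀ k : ℕ, (∑ i ∈ Finset.range k, Ts i) ≤ L →
      ‖sol (Fbar Fe U) ξ e Ts k - sol (Fbar Fa U) ξ e Ts k‖ ≤ alphaIter a Ts k := by
    intro k
    induction k with
    | zero => simp [sol, alphaIter]
    | succ k ih =>
      intro hk
      have hk' : (∑ i ∈ Finset.range k, Ts i) ≤ L := by
        rw [Finset.sum_range_succ] at hk
        linarith [(hTs k).1]
      obtain ⟨hxa, he⟩ := hinv k hk'
      refine hstep _ _ ?_ _ (Metric.self_subset_cthickening X hxa) (ih hk') _ he _ (hTs k)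
      refine Metric.mem_cthickening_of_dist_le _ _ _ _ hxa ?_
      rw [dist_eq_norm]
      exact (ih hk').trans (hiter Ts hTs k hk')
  exact fun k hk => (key k hk).trans (hiter Ts hTs k hk)
end
end

section
/- Suppose that for each pair of compact sets X ⊂ ℝⁿ and E ⊂ ℝⁿ there exist ρ₀ of class K, a nondecreasing function σ: ℝ≥0 → ℝ≥0 and T*>0 such that for all T ∈ (0,T*), all x,y ∈ X and all e ∈ E: |F̄^e(x,e,T) − F̄^a(y,e,T)| ≤ T ρ₀(T) + (1 + T σ(T)) |x−y|. Then the pair (U, F^a) is MSEC with (U, F^e). (Lemma 3 of the paper.) -/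
open scoped BigOperators

noncomputable section

open Topology in
/-- A class-K function is below any positive level at some arbitrarily small positive point. -/
theorem IsClassK.exists_pos_lt {ρ : ℝ → ℝ} (hρ : IsClassK ρ) {c r : ℝ} (hc : 0 < c)
    (hr : 0 < r) : ∃ t > 0, t < r ∧ ρ t < c := by
  have hlim : Filter.Tendsto ρ (𝓝[>] 0) (𝓝 0) := by
    have h := (hρ.1 0 Set.self_mem_Ici).mono Set.Ioi_subset_Ici_self
    rwa [ContinuousWithinAt, hρ.2.2] at h
  obtain ⟨t, ⟨ht0, htr⟩, htc⟩ :=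
    ((Filter.eventually_mem_set.2 (Ioo_mem_nhdsGT hr)).and
      (hlim.eventually_lt_const hc)).exists
  exact ⟨t, ht0, htr, htc⟩

theorem IsClassK.nonneg {ρ : ℝ → ℝ} (hρ : IsClassK ρ) {t : ℝ} (ht : 0 ≤ t) : 0 ≤ ρ t :=
  hρ.2.2 ▸ hρ.2.1.monotoneOn Set.self_mem_Ici ht ht

/-- Discrete Grönwall bound for the iterates of `(d, t) ↦ t * ρ t + (1 + t * σ t) * d`. -/
theorem alphaIter_bound {ρ σ : ℝ → ℝ} {R S : ℝ} {Ts : ℕ → ℝ} (hT : ∀ i, 0 ≤ Ts i)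
    (hρ0 : ∀ i, 0 ≤ ρ (Ts i)) (hρR : ∀ i, ρ (Ts i) ≤ R)
    (hσ0 : ∀ i, 0 ≤ σ (Ts i)) (hσS : ∀ i, σ (Ts i) ≤ S) (k : ℕ) :
    0 ≤ alphaIter (fun d t => t * ρ t + (1 + t * σ t) * d) Ts k ∧
      alphaIter (fun d t => t * ρ t + (1 + t * σ t) * d) Ts k ≤
        R * (∑ i ∈ Finset.range k, Ts i) * Real.exp (S * ∑ i ∈ Finset.range k, Ts i) := by
  have hR : 0 ≤ R := (hρ0 0).trans (hρR 0)
  have hS : 0 ≤ S := (hσ0 0).trans (hσS 0)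
  induction k with
  | zero => simp [alphaIter]
  | succ k ih =>
    obtain ⟨ih0, ih⟩ := ih
    have ht := hT k
    have hr0 := hρ0 k
    have hs0 := hσ0 k
    rw [Finset.sum_range_succ]
    have hs : 0 ≤ ∑ i ∈ Finset.range k, Ts i := Finset.sum_nonneg fun i _ => hT i
    simp only [alphaIter]
    generalize alphaIter (fun d t => t * ρ t + (1 + t * σ t) * d) Ts k = d at *
    generalize ∑ i ∈ Finset.range k, Ts i = s at *
    refine ⟨by positivity, ?_⟩
    have hexp : 1 + Ts k * S ≤ Real.exp (S * Ts k) := by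
      linarith [Real.add_one_le_exp (S * Ts k)]
    have hone : 1 ≤ Real.exp (S * (s + Ts k)) := Real.one_le_exp (by positivity)
    calc Ts k * ρ (Ts k) + (1 + Ts k * σ (Ts k)) * d
        ≤ Ts k * R * 1 + (1 + Ts k * S) * (R * s * Real.exp (S * s)) := by
          rw [mul_one]
          gcongr
          · exact hρR k
          · exact hσS k
      _ ≤ Ts k * R * Real.exp (S * (s + Ts k)) +
            Real.exp (S * Ts k) * (R * s * Real.exp (S * s)) := by gcongr
      _ = R * (s + Ts k) * Real.exp (S * (s + Ts k)) := by
          rw [mul_add S, Real.exp_add]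
          ring

/-- Lemma 3: a one-step bound of the form `T ρ₀(T) + (1 + T σ(T))|x−y|` implies MSEC. -/
theorem MSEC_of_one_step_bound {n m : ℕ} (U : Euc n → ℝ → Euc m)
    (Fa Fe : Euc n → Euc m → ℝ → Euc n)
    (h : ∀ X Eset : Set (Euc n), IsCompact X → IsCompact Eset →
      ∃ ρ₀ : ℝ → ℝ, IsClassK ρ₀ ∧
      ∃ σ : ℝ → ℝ, (∀ s, 0 ≤ s → 0 ≤ σ s) ∧ (∀ s t : ℝ, 0 ≤ s → s ≤ t → σ s ≤ σ t) ∧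
      ∃ Tstar > (0:ℝ),
        ∀ T ∈ Set.Ioo (0:ℝ) Tstar, ∀ x ∈ X, ∀ y ∈ X, ∀ e ∈ Eset,
          ‖Fbar Fe U x e T - Fbar Fa U y e T‖ ≤
            T * ρ₀ T + (1 + T * σ T) * ‖x - y‖) :
    MSEC U Fa Fe := by
  intro L hL η hη X E hX hE
  obtain ⟨ρ, hρ, σ, hσ0, hσ, T₀, hT₀, hstep⟩ := h X E hX hE
  obtain ⟨r, hr, hrT, hρr⟩ :=
    hρ.exists_pos_lt (c := η / (L * Real.exp (σ T₀ * L))) (by positivity) hT₀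
  refine ⟨fun d t => t * ρ t + (1 + t * σ t) * d, fun d t hd ht => ?_, r, hr, ?_, ?_⟩
  · have := hρ.nonneg ht
    have := hσ0 t ht
    positivity
  · intro δ x hx y hy hxy e he T hT
    refine (hstep T ⟨hT.1, hT.2.trans hrT⟩ x hx y hy e he).trans ?_
    have := hT.1.le
    have := hσ0 T hT.1.le
    dsimp only
    gcongr
  · intro Ts hTs k hk
    have hT i : 0 ≤ Ts i := (hTs i).1.le
    have hρr0 := hρ.nonneg hr.le
    have hS := hσ0 T₀ hT₀.le
    have hs : 0 ≤ ∑ i ∈ Finset.range k, Ts i := Finset.sum_nonneg fun i _ => hT i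
    calc _ ≤ ρ r * (∑ i ∈ Finset.range k, Ts i) *
            Real.exp (σ T₀ * ∑ i ∈ Finset.range k, Ts i) :=
          (alphaIter_bound hT (fun i => hρ.nonneg (hT i))
            (fun i => hρ.2.1.monotoneOn (hT i) hr.le (hTs i).2.le)
            (fun i => hσ0 _ (hT i))
            (fun i => hσ _ _ (hT i) ((hTs i).2.trans hrT).le) k).2
      _ ≤ ρ r * L * Real.exp (σ T₀ * L) := by gcongr
      _ ≤ η := by
          rw [mul_assoc]
          exact ((lt_div_iff₀ (by positivity)).1 hρr).le
end
end

section
/- Suppose: (i) F^a is consistent with F^e; (ii) the control law U(x,T) is locally uniformly bounded; and (iii) for each pair of compact sets X, E ⊂ ℝⁿ there exist a nondecreasing function σ: ℝ≥0 → ℝ≥0 and T₁>0 such that for all x,z ∈ X, e ∈ E and T ∈ (0,T₁): |F̄^a(x,e,T) − F̄^a(z,e,T)| ≤ (1 + T σ(T)) |x−z|. Then the pair (U, F^a) is MSEC with (U, F^e). (Lemma 4 of the paper.) -/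
open scoped BigOperators

noncomputable section

/-- A locally uniformly bounded control law. -/
def LocallyUniformlyBounded {n m : ℕ} (U : Euc n → ℝ → Euc m) : Prop :=
  ∀ M > (0:ℝ), ∃ Tstar > (0:ℝ), ∃ C > (0:ℝ),
    ∀ x : Euc n, ‖x‖ ≤ M → ∀ T ∈ Set.Ioo (0:ℝ) Tstar, ‖U x T‖ ≤ C

/-- Discrete Grönwall bound for the iterates of `(d, t) ↦ (1 + t K) d + t ε`. -/
theorem alphaIter_affine_le {K ε : ℝ} (hK : 0 ≤ K) (hε : 0 ≤ ε) {Ts : ℕ → ℝ}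
    (hTs : ∀ i, 0 ≤ Ts i) (k : ℕ) :
    alphaIter (fun d t => (1 + t * K) * d + t * ε) Ts k ≤
      ε * (∑ i ∈ Finset.range k, Ts i) * Real.exp (K * ∑ i ∈ Finset.range k, Ts i) := by
  induction k with
  | zero => simp [alphaIter]
  | succ k ih =>
    rw [Finset.sum_range_succ]
    set S := ∑ i ∈ Finset.range k, Ts i
    have hS : 0 ≤ S := Finset.sum_nonneg fun i _ => hTs i
    have ht := hTs k
    have hexp : 1 + Ts k * K ≤ Real.exp (K * Ts k) := by
      linarith [Real.add_one_le_exp (K * Ts k)]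
    calc (1 + Ts k * K) * alphaIter (fun d t => (1 + t * K) * d + t * ε) Ts k + Ts k * ε
        ≤ (1 + Ts k * K) * (ε * S * Real.exp (K * S)) + Ts k * ε * 1 := by
          rw [mul_one]; gcongr
      _ ≤ Real.exp (K * Ts k) * (ε * S * Real.exp (K * S))
            + Ts k * ε * Real.exp (K * (S + Ts k)) := by
          gcongr
          exact Real.one_le_exp (by positivity)
      _ = ε * (S + Ts k) * Real.exp (K * (S + Ts k)) := by
          rw [mul_add K, Real.exp_add]; ring

/-- A class-K function is below any positive threshold near zero. -/
theorem IsClassK.exists_lt {ρ : ℝ → ℝ} (hρ : IsClassK ρ) {ε : ℝ} (hε : 0 < ε) :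
    ∃ r > (0:ℝ), ∀ T, 0 ≤ T → T < r → ρ T < ε := by
  obtain ⟨hcont, -, h0⟩ := hρ
  obtain ⟨r, hr, h⟩ := Metric.continuousWithinAt_iff.1 (hcont 0 Set.self_mem_Ici) ε hε
  refine ⟨r, hr, fun T hT hTr => ?_⟩
  have := h (x := T) hT (by rwa [Real.dist_eq, sub_zero, abs_of_nonneg hT])
  rw [h0, Real.dist_eq, sub_zero] at this
  exact (le_abs_self _).trans_lt this

/-- Along a locally uniformly bounded control law, consistency gives a closed-loop one-step error
of order `T ε` on compact sets, for every `ε > 0`. -/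
theorem Consistent.exists_norm_Fbar_sub_le {n m : ℕ} {U : Euc n → ℝ → Euc m}
    {Fa Fe : Euc n → Euc m → ℝ → Euc n} (hcons : Consistent Fa Fe)
    (hU : LocallyUniformlyBounded U) {X Eset : Set (Euc n)} (hX : IsCompact X)
    (hE : IsCompact Eset) {ε : ℝ} (hε : 0 < ε) :
    ∃ r > (0:ℝ), ∀ x ∈ X, ∀ e ∈ Eset, ∀ T ∈ Set.Ioo (0:ℝ) r,
      ‖Fbar Fe U x e T - Fbar Fa U x e T‖ ≤ T * ε := by
  obtain ⟨A, hA, hXA⟩ := hX.isBounded.exists_pos_norm_le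
  obtain ⟨B, hB, hEB⟩ := hE.isBounded.exists_pos_norm_le
  obtain ⟨r₁, hr₁, C, -, hC⟩ := hU (A + B) (by positivity)
  obtain ⟨ρ, hρ, r₂, hr₂, hF⟩ := hcons (X ×ˢ Metric.closedBall 0 C)
    (hX.prod (isCompact_closedBall 0 C))
  obtain ⟨r₃, hr₃, hsmall⟩ := hρ.exists_lt hε
  refine ⟨min r₁ (min r₂ r₃), by positivity, fun x hx e he T ⟨hT, hTr⟩ => ?_⟩
  obtain ⟨hT₁, hT₂, hT₃⟩ : T < r₁ ∧ T < r₂ ∧ T < r₃ := by simpa [lt_min_iff] using hTr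
  have hxe : ‖x + e‖ ≤ A + B := norm_add_le_of_le (hXA x hx) (hEB e he)
  have hu : U (x + e) T ∈ Metric.closedBall (0 : Euc m) C :=
    mem_closedBall_zero_iff.2 (hC _ hxe T ⟨hT, hT₁⟩)
  calc ‖Fbar Fe U x e T - Fbar Fa U x e T‖
      ≤ T * ρ T := hF (x, U (x + e) T) ⟨hx, hu⟩ T ⟨hT.le, hT₂.le⟩
    _ ≤ T * ε := by gcongr; exact (hsmall T hT.le hT₃).le

/-- Lemma 4: consistency, a locally uniformly bounded control law, and a Lipschitz-type
one-step property of the approximate closed loop imply MSEC. -/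
theorem MSEC_of_consistency {n m : ℕ} (U : Euc n → ℝ → Euc m)
    (Fa Fe : Euc n → Euc m → ℝ → Euc n)
    -- (i) `Fa` is consistent with `Fe`
    (hcons : Consistent Fa Fe)
    -- (ii) `U` is locally uniformly bounded
    (hU : LocallyUniformlyBounded U)
    -- (iii) one-step Lipschitz-type bound on the approximate closed loop
    (hFa : ∀ X Eset : Set (Euc n), IsCompact X → IsCompact Eset →
      ∃ σ : ℝ → ℝ, (∀ s, 0 ≤ s → 0 ≤ σ s) ∧ (∀ s t : ℝ, 0 ≤ s → s ≤ t → σ s ≤ σ t) ∧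
      ∃ T1 > (0:ℝ),
        ∀ x ∈ X, ∀ z ∈ X, ∀ e ∈ Eset, ∀ T ∈ Set.Ioo (0:ℝ) T1,
          ‖Fbar Fa U x e T - Fbar Fa U z e T‖ ≤ (1 + T * σ T) * ‖x - z‖) :
    MSEC U Fa Fe := by
  intro L hL η hη X Eset hX hE
  obtain ⟨σ, hσ0, hσmono, T₁, hT₁, hlip⟩ := hFa X Eset hX hE
  have hK : 0 ≤ σ 1 := hσ0 1 zero_le_one
  set ε := η / (L * Real.exp (σ 1 * L)) with hεdef
  have hε : 0 < ε := by positivity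
  obtain ⟨r, hr, herr⟩ := hcons.exists_norm_Fbar_sub_le hU hX hE hε
  refine ⟨fun d t => (1 + t * σ 1) * d + t * ε, fun d t hd ht => by positivity,
    min r (min T₁ 1), by positivity, ?_, ?_⟩
  · rintro δ xe hxe xa hxa hδ e he T ⟨hT, hTr⟩
    obtain ⟨hTr, hTT₁, hT1⟩ : T < r ∧ T < T₁ ∧ T < 1 := by simpa [lt_min_iff] using hTr
    have hσ : σ T ≤ σ 1 := hσmono T 1 hT.le hT1.le
    calc ‖Fbar Fe U xe e T - Fbar Fa U xa e T‖
        ≤ ‖Fbar Fe U xe e T - Fbar Fa U xe e T‖ + ‖Fbar Fa U xe e T - Fbar Fa U xa e T‖ :=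
          norm_sub_le_norm_sub_add_norm_sub _ _ _
      _ ≤ T * ε + (1 + T * σ T) * ‖xe - xa‖ :=
          add_le_add (herr xe hxe e he T ⟨hT, hTr⟩) (hlip xe hxe xa hxa e he T ⟨hT, hTT₁⟩)
      _ ≤ T * ε + (1 + T * σ 1) * δ := by gcongr
      _ = (1 + T * σ 1) * δ + T * ε := add_comm _ _
  · intro Ts hTs k hsum
    calc alphaIter (fun d t => (1 + t * σ 1) * d + t * ε) Ts k
        ≤ ε * (∑ i ∈ Finset.range k, Ts i) * Real.exp (σ 1 * ∑ i ∈ Finset.range k, Ts i) :=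
          alphaIter_affine_le hK hε.le (fun i => (hTs i).1.le) k
      _ ≤ ε * L * Real.exp (σ 1 * L) := by gcongr
      _ = η := by rw [hεdef]; field_simp
end
end

section
/- Let ρ₀ be of class K, let σ: ℝ≥0 → ℝ≥0 be nondecreasing, and let T̂ > 0 and L > 0. Let {T_i} be a sequence with T_i ∈ (0,T̂) for all i ∈ ℕ₀, and define recursively η₀ := 0 and η_k := T_{k−1} ρ₀(T_{k−1}) + (1 + T_{k−1} σ(T_{k−1})) η_{k−1} for k ≥ 1. Then for every k ≥ 1 such that Σ_{i=0}^{k−1} T_i ≤ L, one has η_k ≤ e^{σ(T̂) L} ρ₀(T̂) L. (Key estimate in the proof of Lemma 3.) -/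
open scoped BigOperators

noncomputable section

/-- The recursively defined sequence `η₀ = 0`,
`η_k = T_{k-1} ρ₀(T_{k-1}) + (1 + T_{k-1} σ(T_{k-1})) η_{k-1}`. -/
def etaSeq (ρ₀ σ : ℝ → ℝ) (Ts : ℕ → ℝ) : ℕ → ℝ
  | 0 => 0
  | k + 1 => Ts k * ρ₀ (Ts k) + (1 + Ts k * σ (Ts k)) * etaSeq ρ₀ σ Ts k

/-- The discrete Grönwall bound for `etaSeq` in terms of the partial sums of `Ts`. -/
theorem etaSeq_nonneg_and_le_exp_sum (ρ₀ σ : ℝ → ℝ) (Ts : ℕ → ℝ) (r s : ℝ)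
    (hTs : ∀ i, 0 ≤ Ts i) (hρ₀ : ∀ i, 0 ≤ ρ₀ (Ts i)) (hr : ∀ i, ρ₀ (Ts i) ≤ r)
    (hσ : ∀ i, 0 ≤ σ (Ts i)) (hs : ∀ i, σ (Ts i) ≤ s) (k : ℕ) :
    0 ≤ etaSeq ρ₀ σ Ts k ∧
      etaSeq ρ₀ σ Ts k ≤
        Real.exp (s * ∑ i ∈ Finset.range k, Ts i) * r * ∑ i ∈ Finset.range k, Ts i := by
  have hr0 : 0 ≤ r := (hρ₀ 0).trans (hr 0)
  have hs0 : 0 ≤ s := (hσ 0).trans (hs 0)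
  induction k with
  | zero => simp [etaSeq]
  | succ k ih =>
    obtain ⟨h0, hle⟩ := ih
    have ht := hTs k
    have hρk := hρ₀ k
    have hσk := hσ k
    have hS : 0 ≤ ∑ i ∈ Finset.range k, Ts i := Finset.sum_nonneg fun i _ => hTs i
    rw [Finset.sum_range_succ, etaSeq]
    set S := ∑ i ∈ Finset.range k, Ts i
    refine ⟨by positivity, ?_⟩
    have hexp : 1 + Ts k * σ (Ts k) ≤ Real.exp (s * Ts k) := by
      have h1 := Real.add_one_le_exp (s * Ts k)
      have h2 := mul_le_mul_of_nonneg_left (hs k) ht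
      linarith
    have hone : 1 ≤ Real.exp (s * (S + Ts k)) := Real.one_le_exp (by positivity)
    calc Ts k * ρ₀ (Ts k) + (1 + Ts k * σ (Ts k)) * etaSeq ρ₀ σ Ts k
        ≤ 1 * (Ts k * r) + Real.exp (s * Ts k) * (Real.exp (s * S) * r * S) := by
          rw [one_mul]
          gcongr
          exact hr k
      _ ≤ Real.exp (s * (S + Ts k)) * (Ts k * r) +
            Real.exp (s * Ts k) * (Real.exp (s * S) * r * S) := by gcongr
      _ = Real.exp (s * (S + Ts k)) * r * (S + Ts k) := by
          rw [mul_add, Real.exp_add]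
          ring

/-- Key estimate in the proof of Lemma 3. -/
theorem etaSeq_le (ρ₀ σ : ℝ → ℝ) (hρ₀ : IsClassK ρ₀)
    (hσ0 : ∀ s : ℝ, 0 ≤ s → 0 ≤ σ s) (hσ : ∀ s t : ℝ, 0 ≤ s → s ≤ t → σ s ≤ σ t)
    (That L : ℝ) (hThat : 0 < That) (hL : 0 < L)
    (Ts : ℕ → ℝ) (hTs : ∀ i, Ts i ∈ Set.Ioo 0 That) :
    ∀ k : ℕ, 1 ≤ k → (∑ i ∈ Finset.range k, Ts i) ≤ L →
      etaSeq ρ₀ σ Ts k ≤ Real.exp (σ That * L) * ρ₀ That * L := by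
  intro k _ hk
  have hmem : ∀ i, Ts i ∈ Set.Ici (0 : ℝ) := fun i => (hTs i).1.le
  obtain ⟨-, hmono, hzero⟩ := hρ₀
  have hnonneg : ∀ x, 0 ≤ x → 0 ≤ ρ₀ x := fun x hx => by
    simpa [hzero] using hmono.monotoneOn Set.self_mem_Ici hx hx
  have hbound := (etaSeq_nonneg_and_le_exp_sum ρ₀ σ Ts (ρ₀ That) (σ That) hmem
    (fun i => hnonneg _ (hmem i))
    (fun i => hmono.monotoneOn (hmem i) hThat.le (hTs i).2.le)
    (fun i => hσ0 _ (hmem i)) (fun i => hσ _ _ (hmem i) (hTs i).2.le) k).2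
  have hr0 := hnonneg That hThat.le
  have hs0 := hσ0 That hThat.le
  have hS : 0 ≤ ∑ i ∈ Finset.range k, Ts i := Finset.sum_nonneg fun i _ => hmem i
  refine hbound.trans ?_
  gcongr
end
end

section
/- Let F̄: ℝⁿ×ℝⁿ×ℝ → ℝⁿ, V: ℝⁿ → ℝ≥0, and α₁, α₂ of class K∞ with α₁(|x|) ≤ V(x) ≤ α₂(|x|) for all x ∈ ℝⁿ. Let E, R', M, T⋆, c > 0 be constants such that: (a) α₁(|x|) ≤ α₂(c) implies |x| ≤ M; (b) V(F̄(x,e,T)) ≤ V(x) whenever R' ≤ |x| ≤ M, |e| ≤ E and T ∈ (0,T⋆); and (c) |F̄(x,e,T)| ≤ c whenever |x| ≤ R', |e| ≤ E and T ∈ (0,T⋆). Then for every solution of x_{k+1} = F̄(x_k, e_k, T_k) with |e_k| ≤ E and T_k ∈ (0,T⋆) for all k: if V(x_ℓ) ≤ α₂(c) for some ℓ ∈ ℕ₀, then V(x_k) ≤ α₂(c) (and hence |x_k| ≤ M) for all k ≥ ℓ. (Forward-invariance argument of Claims 2 and 3 in the proof of Theorem 2.) -/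
open scoped BigOperators

noncomputable section

/-- Class-K∞ function. -/
def IsClassKInf (α : ℝ → ℝ) : Prop :=
  IsClassK α ∧ Filter.Tendsto α Filter.atTop Filter.atTop

/-- Forward-invariance argument of Claims 2 and 3 in the proof of Theorem 2. -/
theorem sublevel_forward_invariant {n : ℕ} (F : Euc n → Euc n → ℝ → Euc n)
    (V : Euc n → ℝ) (α₁ α₂ : ℝ → ℝ) (hα₁ : IsClassKInf α₁) (hα₂ : IsClassKInf α₂)
    (hV0 : ∀ x, 0 ≤ V x)
    (hsand : ∀ x : Euc n, α₁ ‖x‖ ≤ V x ∧ V x ≤ α₂ ‖x‖)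
    (Em R' M Tstar c : ℝ)
    (hEm : 0 < Em) (hR' : 0 < R') (hM : 0 < M) (hTstar : 0 < Tstar) (hc : 0 < c)
    -- (a) the `α₂ c` sublevel set of `α₁ ∘ ‖·‖` is contained in the ball of radius `M`
    (ha : ∀ x : Euc n, α₁ ‖x‖ ≤ α₂ c → ‖x‖ ≤ M)
    -- (b) `V` does not increase along solutions in the annulus `R' ≤ ‖x‖ ≤ M`
    (hb : ∀ x e : Euc n, ∀ T : ℝ, R' ≤ ‖x‖ → ‖x‖ ≤ M → ‖e‖ ≤ Em →
      T ∈ Set.Ioo 0 Tstar → V (F x e T) ≤ V x)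
    -- (c) one-step bound starting from the ball of radius `R'`
    (hcc : ∀ x e : Euc n, ∀ T : ℝ, ‖x‖ ≤ R' → ‖e‖ ≤ Em →
      T ∈ Set.Ioo 0 Tstar → ‖F x e T‖ ≤ c)
    (ξ : Euc n) (e : ℕ → Euc n) (Ts : ℕ → ℝ)
    (he : ∀ k, ‖e k‖ ≤ Em) (hTs : ∀ k, Ts k ∈ Set.Ioo 0 Tstar)
    (ℓ : ℕ) (hℓ : V (sol F ξ e Ts ℓ) ≤ α₂ c) :
    ∀ k : ℕ, ℓ ≤ k → V (sol F ξ e Ts k) ≤ α₂ c ∧ ‖sol F ξ e Ts k‖ ≤ M := by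
  have bound : ∀ x, V x ≤ α₂ c → ‖x‖ ≤ M := fun x hx => ha x ((hsand x).1.trans hx)
  intro k hk
  suffices h : V (sol F ξ e Ts k) ≤ α₂ c from ⟨h, bound _ h⟩
  induction k, hk using Nat.le_induction with
  | base => exact hℓ
  | succ k _ ih =>
    change V (F (sol F ξ e Ts k) (e k) (Ts k)) ≤ α₂ c
    rcases le_total R' ‖sol F ξ e Ts k‖ with h | h
    · exact (hb _ _ _ h (bound _ ih) (he k) (hTs k)).trans ih
    · exact (hsand _).2.trans (hα₂.1.2.1.monotoneOn (norm_nonneg _) hc.le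
        (hcc _ _ _ h (he k) (hTs k)))
end
end

section
/- Define F̄^a(x,e,T) := x − T·(2x³ + 9ex² + (9e² + 1)x + 3e³ + e) and V(x) := x². Fix M ≥ R > 0 and E > 0, let g(x,e) := (2x³ + 9ex² + (9e² + 1)x + 3e³ + e)², let G := sup{ g(x,e) : |x| ≤ M, |e| ≤ E } (which is positive and finite), and let T̃ := 1.8 R² / G. Then for all x, e, T with 10|e| + R ≤ |x| ≤ M, |e| ≤ E and T ∈ (0,T̃): V(F̄^a(x,e,T)) − V(x) ≤ −T · 2.194 x⁴. (Lyapunov decrease estimate in Section IV-A.) -/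
noncomputable section

/-- Closed-loop Euler approximate model of `ẋ = x³ + u` under `u = −(x+e) − 3(x+e)³`. -/
def FbarA (x e T : ℝ) : ℝ :=
  x - T * (2 * x ^ 3 + 9 * e * x ^ 2 + (9 * e ^ 2 + 1) * x + 3 * e ^ 3 + e)

/-- Lyapunov function `V(x) = x²`. -/
def Vf (x : ℝ) : ℝ := x ^ 2

/-- `g(x,e)`, the coefficient of `T²` in `V(F̄ᵃ(x,e,T)) − V(x)`. -/
def gf (x e : ℝ) : ℝ :=
  (2 * x ^ 3 + 9 * e * x ^ 2 + (9 * e ^ 2 + 1) * x + 3 * e ^ 3 + e) ^ 2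

lemma bddAbove_gf_values (M E : ℝ) :
    BddAbove {r : ℝ | ∃ x e : ℝ, |x| ≤ M ∧ |e| ≤ E ∧ r = gf x e} := by
  have hcont : Continuous fun p : ℝ × ℝ => gf p.1 p.2 := by
    unfold gf
    fun_prop
  refine (((isCompact_Icc (a := -M) (b := M)).prod
    (isCompact_Icc (a := -E) (b := E))).bddAbove_image hcont.continuousOn).mono ?_
  rintro r ⟨x, e, hx, he, rfl⟩
  exact ⟨(x, e), ⟨abs_le.mp hx, abs_le.mp he⟩, rfl⟩

lemma Vf_FbarA_sub_Vf (x e T : ℝ) :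
    Vf (FbarA x e T) - Vf x = -T * (2 * x *
      (2 * x ^ 3 + 9 * e * x ^ 2 + (9 * e ^ 2 + 1) * x + 3 * e ^ 3 + e)) + T * (T * gf x e) := by
  unfold Vf FbarA gf
  ring

lemma first_order_decrease_lower_bound {x e : ℝ} (h : 10 * |e| ≤ |x|) :
    2.194 * x ^ 4 + 1.8 * x ^ 2 ≤
      2 * x * (2 * x ^ 3 + 9 * e * x ^ 2 + (9 * e ^ 2 + 1) * x + 3 * e ^ 3 + e) := by
  have hex : 0 ≤ 10 * (e * x) + x ^ 2 := by
    have := neg_abs_le (e * x)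
    rw [abs_mul] at this
    nlinarith [mul_le_mul_of_nonneg_right h (abs_nonneg x), abs_mul_abs_self x]
  have hex' : 0 ≤ e * x + 3 * x ^ 2 := by nlinarith [sq_nonneg x]
  nlinarith [mul_nonneg hex (sq_nonneg x), mul_nonneg hex' (sq_nonneg e), sq_nonneg (x ^ 2)]

/-- Lyapunov decrease estimate of Section IV-A. -/
theorem lyapunov_decrease (M R E : ℝ) (hR : 0 < R) (hMR : R ≤ M) (hE : 0 < E) :
    letI G : ℝ := sSup {r : ℝ | ∃ x e : ℝ, |x| ≤ M ∧ |e| ≤ E ∧ r = gf x e}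
    BddAbove {r : ℝ | ∃ x e : ℝ, |x| ≤ M ∧ |e| ≤ E ∧ r = gf x e} ∧ 0 < G ∧
      ∀ x e T : ℝ, 10 * |e| + R ≤ |x| → |x| ≤ M → |e| ≤ E →
        T ∈ Set.Ioo 0 (1.8 * R ^ 2 / G) →
          Vf (FbarA x e T) - Vf x ≤ -T * (2.194 * x ^ 4) := by
  have hM : 0 < M := hR.trans_le hMR
  have hbdd := bddAbove_gf_values M E
  have hG : 0 < sSup {r : ℝ | ∃ x e : ℝ, |x| ≤ M ∧ |e| ≤ E ∧ r = gf x e} := by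
    have hpos : 0 < gf M 0 := by
      unfold gf
      ring_nf
      positivity
    exact hpos.trans_le
      (le_csSup hbdd ⟨M, 0, (abs_of_pos hM).le, by simpa using hE.le, rfl⟩)
  refine ⟨hbdd, hG, fun x e T hxe hx he hT => ?_⟩
  obtain ⟨hT0, hT1⟩ := hT
  rw [lt_div_iff₀ hG] at hT1
  have hg := mul_le_mul_of_nonneg_left (le_csSup hbdd ⟨x, e, hx, he, rfl⟩) hT0.le
  have hRx : R ^ 2 ≤ x ^ 2 := by
    rw [← sq_abs x]
    gcongr
    linarith [abs_nonneg e]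
  have hfirst := first_order_decrease_lower_bound (x := x) (e := e) (by linarith)
  have hsecond : T * gf x e ≤ 1.8 * x ^ 2 := by linarith
  rw [Vf_FbarA_sub_Vf]
  linarith [mul_le_mul_of_nonneg_left (add_le_add hfirst hsecond) hT0.le]
end
end
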